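/- Compact support of minimizers: let 0 < k < 2, J > 0, M > 0 with I^k_{M,J} < M, and let (f₀,φ₀) be a minimizer of the energy functional over the admissible pairs. Then f₀ has compact support: f₀(x,p) = 0 for almost every (x,p) with |p| ≥ 1, and there exists R > 0 such that f₀(x,p) = 0 for almost every (x,p) with |x| ≥ R. -/

import Mathlib

open MeasureTheory Real Filter Topology
open scoped ENNReal

noncomputable section

/-- Euclidean 3-space. -/
abbrev E3 := EuclideanSpace ℝ (Fin 3)

/-- `φ` belongs to (a C¹ surrogate of) the space `D¹(ℝ³)`: it is continuously
differentiable, its gradient is square integrable and it vanishes at infinity in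
the sense that `{|φ| > a}` has finite measure for every `a > 0`. -/
def IsPotential (φ : E3 → ℝ) : Prop :=
  ContDiff ℝ 1 φ ∧ (∫⁻ x : E3, ENNReal.ofReal (‖gradient φ x‖ ^ 2)) < ⊤ ∧
    ∀ a : ℝ, 0 < a → volume {x : E3 | a < |φ x|} < ⊤

/-- `f ∈ Γ^k_{M,J}`: `f` is measurable, a.e. nonnegative, with `‖f‖_{L¹} = M` and
`‖f‖_{L^{1+1/k}} ≤ J` (in particular `f ∈ L¹ ∩ L^{1+1/k}`). -/
def InGamma (k M J : ℝ) (f : E3 → E3 → ℝ) : Prop :=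
  Measurable (Function.uncurry f) ∧
  (∀ᵐ z : E3 × E3, 0 ≤ f z.1 z.2) ∧
  (∫⁻ z : E3 × E3, ENNReal.ofReal (f z.1 z.2)) = ENNReal.ofReal M ∧
  eLpNorm (Function.uncurry f) (ENNReal.ofReal (1 + 1/k)) volume ≤ ENNReal.ofReal J

/-- Kinetic energy `E_kin(f,φ) = ∫∫ √(e^{2φ(x)}+|p|²) f(x,p) dp dx` (value in `[0,∞]`). -/
def kinE (f : E3 → E3 → ℝ) (φ : E3 → ℝ) : ℝ≥0∞ :=
  ∫⁻ z : E3 × E3, ENNReal.ofReal (Real.sqrt (Real.exp (2 * φ z.1) + ‖z.2‖ ^ 2) * f z.1 z.2)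

/-- Energy functional `𝓔(f,φ) = E_kin(f,φ) + (1/2)∫ |∇φ|²` (value in `[0,∞]`). -/
def energy (f : E3 → E3 → ℝ) (φ : E3 → ℝ) : ℝ≥0∞ :=
  kinE f φ + (∫⁻ x : E3, ENNReal.ofReal (‖gradient φ x‖ ^ 2)) / 2

/-- `(f,φ)` is admissible: `f ∈ Γ^k_{M,J}`, `φ` is a potential and
`∫∫ √(1+|p|²) f dp dx < ∞`. -/
def Admissible (k M J : ℝ) (f : E3 → E3 → ℝ) (φ : E3 → ℝ) : Prop :=
  InGamma k M J f ∧ IsPotential φ ∧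
  (∫⁻ z : E3 × E3, ENNReal.ofReal (Real.sqrt (1 + ‖z.2‖ ^ 2) * f z.1 z.2)) < ⊤

/-- The energy infimum `I^k_{M,J} = inf {𝓔(f,φ) : (f,φ) admissible}`. -/
def energyInf (k M J : ℝ) : ℝ≥0∞ :=
  sInf { e : ℝ≥0∞ | ∃ f φ, Admissible k M J f φ ∧ e = energy f φ }


lemma lint_smul (a : ℝ) (ha : 0 < a) (F : E3 → ℝ≥0∞) :
    ∫⁻ x : E3, F (a • x) = ENNReal.ofReal ((a ^ 3)⁻¹) * ∫⁻ x : E3, F x := by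
  have h := Measure.map_addHaar_smul (volume : Measure E3) ha.ne'
  have h2 : ∫⁻ x : E3, F x ∂(Measure.map (a • ·) (volume : Measure E3)) = ∫⁻ x : E3, F (a • x) :=
    ((Homeomorph.smulOfNeZero a ha.ne').measurableEmbedding).lintegral_map F
  rw [← h2, h, lintegral_smul_measure]
  simp [abs_of_pos, ha]

lemma lint_smul_prod (a : ℝ) (ha : 0 < a) (F : E3 × E3 → ℝ≥0∞) (hF : Measurable F) :
    ∫⁻ z : E3 × E3, F (a • z.1, z.2) = ENNReal.ofReal ((a ^ 3)⁻¹) * ∫⁻ z : E3 × E3, F z := by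
  have hm : Measurable (fun z : E3 × E3 => F (a • z.1, z.2)) := by fun_prop
  rw [Measure.volume_eq_prod, lintegral_prod _ hm.aemeasurable, lintegral_prod _ hF.aemeasurable,
    ← lint_smul a ha]

lemma gradient_comp_smul (φ : E3 → ℝ) (hφ : ContDiff ℝ 1 φ) (a : ℝ) (x : E3) :
    gradient (fun y => φ (a • y)) x = a • gradient φ (a • x) := by
  apply HasGradientAt.gradient
  rw [hasGradientAt_iff_hasFDerivAt]
  have h1 : HasFDerivAt φ (fderiv ℝ φ (a • x)) (a • x) :=
    (hφ.differentiable (by norm_num) _).hasFDerivAt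
  have h2 : HasFDerivAt (fun y : E3 => a • y) (a • ContinuousLinearMap.id ℝ E3) x :=
    (hasFDerivAt_id x).const_smul a
  refine (h1.comp x h2).congr_fderiv ?_
  apply ContinuousLinearMap.ext
  intro v
  rw [InnerProductSpace.toDual_apply_apply, inner_smul_left, inner_gradient_left]
  simp

lemma scaled_admissible (k M M' J a : ℝ) (hk : 0 < k) (hk2 : k < 2) (hM : 0 < M) (ha : 0 < a)
    (ha1 : a ≤ 1) (haM : M' = a * M)
    (g : E3 → E3 → ℝ) (φ : E3 → ℝ) (h : Admissible k M' J g φ) (hg : ∀ x p, 0 ≤ g x p) :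
    Admissible k M J (fun x p => a ^ 2 * g (a • x) p) (fun x => φ (a • x)) ∧
    energy (fun x p => a ^ 2 * g (a • x) p) (fun x => φ (a • x))
      = ENNReal.ofReal a⁻¹ * energy g φ := by
  obtain ⟨⟨hmeas, hpos, hmass, hLq⟩, ⟨hC, hG, hvan⟩, hfin⟩ := h
  have hmeas' : Measurable (fun z : E3 × E3 => g z.1 z.2) := hmeas
  have hφc : Measurable φ := hC.continuous.measurable
  have hsc : ENNReal.ofReal (a ^ 2) * ENNReal.ofReal ((a ^ 3)⁻¹) = ENNReal.ofReal a⁻¹ := by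
    rw [← ENNReal.ofReal_mul (by positivity)]
    congr 1
    field_simp
  have hgrad : (∫⁻ x : E3, ENNReal.ofReal (‖gradient (fun x => φ (a • x)) x‖ ^ 2))
      = ENNReal.ofReal a⁻¹ * ∫⁻ x : E3, ENNReal.ofReal (‖gradient φ x‖ ^ 2) := by
    simp_rw [gradient_comp_smul φ hC a, norm_smul, mul_pow]
    rw [← hsc, mul_assoc, ← lint_smul a ha, ← lintegral_const_mul']
    · apply lintegral_congr
      intro x
      rw [← ENNReal.ofReal_mul (by positivity)]
      simp
    · simp
  have hgen : ∀ w : E3 × E3 → ℝ, Measurable w → (∀ z, 0 ≤ w z) →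
      (∫⁻ z : E3 × E3, ENNReal.ofReal (w (a • z.1, z.2) * (a ^ 2 * g (a • z.1) z.2)))
       = ENNReal.ofReal a⁻¹ * ∫⁻ z : E3 × E3, ENNReal.ofReal (w z * g z.1 z.2) := by
    intro w hw hw0
    rw [← hsc, mul_assoc, ← lint_smul_prod a ha _ (by fun_prop), ← lintegral_const_mul']
    · apply lintegral_congr
      intro z
      rw [← ENNReal.ofReal_mul (by positivity)]
      congr 1
      ring
    · simp
  refine ⟨⟨⟨?_, ?_, ?_, ?_⟩, ⟨?_, ?_, ?_⟩, ?_⟩, ?_⟩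
  · show Measurable (fun z : E3 × E3 => a ^ 2 * g (a • z.1) z.2)
    have : Measurable (fun z : E3 × E3 => g (a • z.1) z.2) :=
      hmeas'.comp (g := fun z : E3 × E3 => g z.1 z.2) (f := fun z : E3 × E3 => (a • z.1, z.2)) (by fun_prop)
    fun_prop
  · exact Eventually.of_forall fun z => mul_nonneg (by positivity) (hg _ _)
  · have := hgen (fun _ => 1) (by fun_prop) (by simp)
    simp only [one_mul] at this
    rw [this, hmass, ← ENNReal.ofReal_mul (by positivity), haM]
    congr 1
    field_simp
  · set q : ℝ := 1 + 1/k with hq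
    have hq1 : 3/2 < q := by
      have : 1/2 < 1/k := one_div_lt_one_div_of_lt hk hk2
      linarith
    have hq0 : 0 < q := by linarith
    refine le_trans ?_ hLq
    have hne : ENNReal.ofReal q ≠ 0 := by simpa using hq0
    rw [eLpNorm_eq_lintegral_rpow_enorm_toReal hne (by simp), eLpNorm_eq_lintegral_rpow_enorm_toReal hne (by simp),
      ENNReal.toReal_ofReal hq0.le]
    apply ENNReal.rpow_le_rpow _ (by positivity)
    have key : ∀ z : E3 × E3, ‖Function.uncurry (fun x p => a ^ 2 * g (a • x) p) z‖ₑ ^ q =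
        ENNReal.ofReal (a ^ 2) ^ q * (fun z : E3 × E3 => ‖g z.1 z.2‖ₑ ^ q) (a • z.1, z.2) := by
      intro z
      simp only [Function.uncurry]
      rw [enorm_mul, ENNReal.mul_rpow_of_nonneg _ _ hq0.le, Real.enorm_of_nonneg (by positivity)]
    simp_rw [key]
    have e := lint_smul_prod a ha (fun z => ‖g z.1 z.2‖ₑ ^ q) (by fun_prop)
    rw [lintegral_const_mul', e, ← mul_assoc]
    · refine mul_le_of_le_one_left (by positivity) ?_
      rw [ENNReal.ofReal_rpow_of_nonneg (by positivity) hq0.le, ← ENNReal.ofReal_mul (by positivity)]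
      rw [ENNReal.ofReal_le_one, ← div_eq_mul_inv, div_le_one (by positivity),
        ← Real.rpow_natCast a 2, ← Real.rpow_natCast a 3, ← Real.rpow_mul ha.le]
      apply Real.rpow_le_rpow_of_exponent_ge ha ha1
      push_cast
      linarith
    · exact ENNReal.rpow_ne_top_of_nonneg hq0.le (by simp)
  · exact hC.comp (contDiff_const_smul a)
  · rw [hgrad]
    exact ENNReal.mul_lt_top (by simp) hG
  · intro b hb
    have := Measure.addHaar_preimage_smul (volume : Measure E3) ha.ne' {x : E3 | b < |φ x|}
    have h2 : {x : E3 | b < |φ (a • x)|} = (a • ·) ⁻¹' {x : E3 | b < |φ x|} := rfl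
    rw [h2, this]
    exact ENNReal.mul_lt_top (by simp) (hvan b hb)
  · have := hgen (fun z => Real.sqrt (1 + ‖z.2‖ ^ 2)) (by fun_prop) (fun z => Real.sqrt_nonneg _)
    rw [this]
    exact ENNReal.mul_lt_top (by simp) hfin
  · have := hgen (fun z => Real.sqrt (Real.exp (2 * φ z.1) + ‖z.2‖ ^ 2)) (by fun_prop) (fun z => Real.sqrt_nonneg _)
    unfold energy kinE
    rw [this, hgrad, mul_add, mul_div_assoc]

lemma support_energy (k M J : ℝ)
    (hk : 0 < k) (hk2 : k < 2) (hM : 0 < M)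
    (hlt : energyInf k M J < ENNReal.ofReal M)
    (f₀ : E3 → E3 → ℝ) (φ₀ : E3 → ℝ)
    (hadm : Admissible k M J f₀ φ₀)
    (hmin : energy f₀ φ₀ = energyInf k M J) :
    ∃ c : ℝ, 0 < c ∧ c < 1 ∧ ∀ᵐ z : E3 × E3,
      c < Real.sqrt (Real.exp (2 * φ₀ z.1) + ‖z.2‖ ^ 2) → f₀ z.1 z.2 = 0 := by
  have hadm' := hadm
  obtain ⟨⟨hmeas, hpos, hmass, hLq⟩, ⟨hC, hG, hvan⟩, hfin⟩ := hadm
  have hmeas' : Measurable (fun z : E3 × E3 => f₀ z.1 z.2) := hmeas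
  have hφc : Measurable φ₀ := hC.continuous.measurable
  have hElt : energy f₀ φ₀ < ENNReal.ofReal M := hmin ▸ hlt
  have hEtop : energy f₀ φ₀ ≠ ⊤ := (hElt.trans_le le_top).ne
  set h : E3 × E3 → ℝ := fun z => Real.sqrt (Real.exp (2 * φ₀ z.1) + ‖z.2‖ ^ 2) with hh
  have hhm : Measurable h := by fun_prop
  have hh0 : ∀ z, 0 ≤ h z := fun z => Real.sqrt_nonneg _
  set c0 : ℝ := (energy f₀ φ₀).toReal / M with hc0
  have hc01 : c0 < 1 := by
    rw [hc0, div_lt_one hM]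
    exact (ENNReal.toReal_lt_of_lt_ofReal hElt)
  set c : ℝ := max c0 (1/2) with hc
  have hcpos : 0 < c := lt_of_lt_of_le (by norm_num) (le_max_right _ _)
  refine ⟨c, hcpos, max_lt hc01 (by norm_num), ?_⟩
  set S : Set (E3 × E3) := {z | c < h z} with hS
  have hSm : MeasurableSet S := measurableSet_lt measurable_const hhm
  set u : E3 × E3 → ℝ := S.indicator (fun _ => (1 : ℝ)) with hu
  have hum : Measurable u := measurable_const.indicator hSm
  have hu0 : ∀ z, 0 ≤ u z := fun z => Set.indicator_nonneg (fun _ _ => zero_le_one) z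
  have hu1 : ∀ z, u z ≤ 1 := fun z => Set.indicator_le_self' (f := fun _ => (1:ℝ)) (fun _ _ => zero_le_one) z
  set g : E3 → E3 → ℝ := fun x p => max (f₀ x p) 0 * (1 - u (x, p) / 2) with hgdef
  have hg0 : ∀ x p, 0 ≤ g x p := fun x p =>
    mul_nonneg (le_max_right _ _) (by have := hu1 (x,p); linarith)
  have hgm : Measurable (fun z : E3 × E3 => g z.1 z.2) := by
    simp only [hgdef]
    fun_prop
  have hgle : ∀ x p, g x p ≤ max (f₀ x p) 0 := fun x p =>
    mul_le_of_le_one_right (le_max_right _ _) (by have := hu0 (x,p); linarith)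
  have hsplit : ∀ w : E3 × E3 → ℝ, Measurable w → (∀ z, 0 ≤ w z) →
      (∫⁻ z, ENNReal.ofReal (w z * g z.1 z.2)) + ENNReal.ofReal (1/2) * ∫⁻ z in S, ENNReal.ofReal (w z * f₀ z.1 z.2)
        = ∫⁻ z, ENNReal.ofReal (w z * f₀ z.1 z.2) := by
    intro w hw hw0
    rw [← lintegral_indicator hSm, ← lintegral_const_mul' _ _ (by simp), ← lintegral_add_left (by fun_prop)]
    apply lintegral_congr_ae
    filter_upwards [hpos] with z hz
    by_cases hzS : z ∈ S
    · have : u z = 1 := by simp [hu, hzS]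
      rw [Set.indicator_of_mem hzS, ← ENNReal.ofReal_mul (by norm_num),
        ← ENNReal.ofReal_add (mul_nonneg (hw0 z) (hg0 _ _)) (by have := mul_nonneg (hw0 z) hz; linarith)]
      simp only [hgdef, Prod.mk.eta, this, max_eq_left hz]
      congr 1
      ring
    · have : u z = 0 := by simp [hu, hzS]
      rw [Set.indicator_of_notMem hzS]
      simp [hgdef, this, max_eq_left hz]
  have hm1 := hsplit (fun _ => 1) (by fun_prop) (by simp)
  have hm2 := hsplit h hhm hh0
  simp only [one_mul, hmass] at hm1
  set mS := ∫⁻ z in S, ENNReal.ofReal (f₀ z.1 z.2) with hmS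
  set kS := ∫⁻ z in S, ENNReal.ofReal (h z * f₀ z.1 z.2) with hkS
  have hmSle : mS ≤ ENNReal.ofReal M := hmass ▸ setLIntegral_le_lintegral _ _
  have hmSfin : mS ≠ ⊤ := (hmSle.trans_lt (by simp)).ne
  have hmSreal : mS.toReal ≤ M := ENNReal.toReal_le_of_le_ofReal hM.le hmSle
  have hmS0 : 0 ≤ mS.toReal := ENNReal.toReal_nonneg
  have hen : energy g φ₀ + ENNReal.ofReal (1/2) * kS = energy f₀ φ₀ := by
    unfold energy kinE
    rw [← hm2]
    ring
  have hegtop : energy g φ₀ ≠ ⊤ := fun hcon => hEtop (by rw [← hen, hcon]; simp)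
  have hkSfin : kS ≠ ⊤ := by
    intro hcon
    apply hEtop
    rw [← hen, hcon, ENNReal.mul_top (by simp)]
    simp
  set M' : ℝ := M - mS.toReal / 2 with hM'
  have hM'0 : 0 < M' := by linarith
  have hmassg : (∫⁻ z : E3 × E3, ENNReal.ofReal (g z.1 z.2)) = ENNReal.ofReal M' := by
    rw [hM', ENNReal.ofReal_sub _ (by positivity), ← hm1]
    have : ENNReal.ofReal (mS.toReal / 2) = ENNReal.ofReal (1/2) * mS := by
      rw [div_eq_mul_one_div, mul_comm, ENNReal.ofReal_mul (by norm_num), ENNReal.ofReal_toReal hmSfin]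
    rw [this, ENNReal.add_sub_cancel_right]
    exact ENNReal.mul_ne_top (by simp) hmSfin
  have hadmg : Admissible k M' J g φ₀ := by
    refine ⟨⟨hgm, Eventually.of_forall fun z => hg0 _ _, hmassg, ?_⟩, ⟨hC, hG, hvan⟩, ?_⟩
    · refine le_trans (eLpNorm_mono_ae ?_) hLq
      filter_upwards [hpos] with z hz
      simp only [Function.uncurry]
      rw [Real.norm_of_nonneg (hg0 _ _), Real.norm_of_nonneg hz]
      exact (hgle _ _).trans (max_eq_left hz).le
    · refine lt_of_le_of_lt (lintegral_mono_ae ?_) hfin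
      filter_upwards [hpos] with z hz
      apply ENNReal.ofReal_le_ofReal
      exact mul_le_mul_of_nonneg_left ((hgle _ _).trans (max_eq_left hz).le) (Real.sqrt_nonneg _)
  set a : ℝ := M' / M with ha
  have ha0 : 0 < a := by positivity
  have ha1 : a ≤ 1 := by rw [ha, div_le_one hM]; linarith
  obtain ⟨hA, hE⟩ := scaled_admissible k M M' J a hk hk2 hM ha0 ha1 (by rw [ha]; field_simp) g φ₀ hadmg hg0
  have hle : energy f₀ φ₀ ≤ ENNReal.ofReal a⁻¹ * energy g φ₀ := by
    rw [← hE, hmin]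
    exact sInf_le ⟨_, _, hA, rfl⟩
  have hleR := ENNReal.toReal_mono (ENNReal.mul_ne_top (by simp) hegtop) hle
  rw [ENNReal.toReal_mul, ENNReal.toReal_ofReal (by positivity)] at hleR
  have henR := congrArg ENNReal.toReal hen
  rw [ENNReal.toReal_add hegtop (ENNReal.mul_ne_top (by simp) hkSfin), ENNReal.toReal_mul,
    ENNReal.toReal_ofReal (by norm_num)] at henR
  have hk1 : kS.toReal ≤ c0 * mS.toReal := by
    have h1 : a * (energy f₀ φ₀).toReal ≤ (energy g φ₀).toReal := by
      rwa [inv_mul_eq_div, le_div_iff₀ ha0, mul_comm] at hleR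
    have h2 : a = 1 - mS.toReal / (2 * M) := by
      rw [ha, hM']; field_simp
    rw [h2] at h1
    have h3 : c0 * mS.toReal = 2 * (mS.toReal / (2 * M) * (energy f₀ φ₀).toReal) := by
      rw [hc0]; field_simp
    rw [h3]
    linarith
  have hk2' : kS ≤ ENNReal.ofReal c * mS := by
    rw [← ENNReal.ofReal_toReal hkSfin, ← ENNReal.ofReal_toReal hmSfin, ← ENNReal.ofReal_mul hcpos.le]
    exact ENNReal.ofReal_le_ofReal (hk1.trans (mul_le_mul_of_nonneg_right (le_max_left _ _) hmS0))
  have hcm : ENNReal.ofReal c * mS = ∫⁻ z in S, ENNReal.ofReal (c * f₀ z.1 z.2) := by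
    rw [hmS, ← lintegral_const_mul' _ _ (by simp)]
    simp_rw [ENNReal.ofReal_mul hcpos.le]
  rw [hcm] at hk2'
  have hae := ae_eq_of_ae_le_of_lintegral_le (μ := volume.restrict S)
    (f := fun z : E3 × E3 => ENNReal.ofReal (c * f₀ z.1 z.2)) (g := fun z : E3 × E3 => ENNReal.ofReal (h z * f₀ z.1 z.2))
    (by
      rw [EventuallyLE, ae_restrict_iff' hSm]
      filter_upwards [hpos] with z hz hzS
      exact ENNReal.ofReal_le_ofReal (mul_le_mul_of_nonneg_right (le_of_lt hzS) hz))
    (by rw [← hcm]; exact ENNReal.mul_ne_top (by simp) hmSfin) (by fun_prop) hk2'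
  rw [EventuallyEq, ae_restrict_iff' hSm] at hae
  filter_upwards [hae, hpos] with z h1 hz hzS
  have h2 := h1 hzS
  rw [ENNReal.ofReal_eq_ofReal_iff (mul_nonneg hcpos.le hz) (mul_nonneg (hh0 z) hz)] at h2
  have h3 : c < h z := hzS
  have h4 : (h z - c) * f₀ z.1 z.2 = 0 := by linarith
  rcases mul_eq_zero.1 h4 with h5 | h5
  · linarith
  · exact h5

lemma cont_gradient (φ : E3 → ℝ) (hφ : ContDiff ℝ 1 φ) : Continuous (gradient φ) := by
  unfold gradient
  exact (InnerProductSpace.toDual ℝ E3).symm.continuous.comp (hφ.continuous_fderiv (by norm_num))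

lemma gradient_add_smul (φ η : E3 → ℝ) (hφ : ContDiff ℝ 1 φ) (hη : ContDiff ℝ 1 η) (t : ℝ) (x : E3) :
    gradient (fun y => φ y + t * η y) x = gradient φ x + t • gradient η x := by
  apply HasGradientAt.gradient
  rw [hasGradientAt_iff_hasFDerivAt]
  have h1 : HasFDerivAt φ (fderiv ℝ φ x) x :=
    (hφ.differentiable (by norm_num) _).hasFDerivAt
  have h2 : HasFDerivAt η (fderiv ℝ η x) x :=
    (hη.differentiable (by norm_num) _).hasFDerivAt
  refine (h1.add (h2.const_mul t)).congr_fderiv ?_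
  apply ContinuousLinearMap.ext
  intro v
  rw [InnerProductSpace.toDual_apply_apply, inner_add_left, inner_smul_left, inner_gradient_left, inner_gradient_left]
  simp

lemma sqrt_pert (φ p t η : ℝ) (ht : 0 ≤ t) (hη0 : 0 ≤ η) (hη1 : η ≤ 1) (hφ : φ ≤ 0) :
    Real.sqrt (Real.exp (2 * (φ + t * η)) + p ^ 2) ≤
      Real.sqrt (Real.exp (2 * φ) + p ^ 2) + t * Real.exp t * η := by
  have hte : 0 ≤ t * η := by positivity
  have e1 : Real.exp (2 * (φ + t * η)) = Real.exp (φ + t * η) ^ 2 := by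
    rw [← Real.exp_nat_mul]; push_cast; rfl
  have e2 : Real.exp (2 * φ) = Real.exp φ ^ 2 := by
    rw [← Real.exp_nat_mul]; push_cast; rfl
  rw [e1, e2]
  have hd : Real.exp (φ + t * η) - Real.exp φ ≤ t * Real.exp t * η := by
    have h1 : Real.exp (t * η) - 1 ≤ t * η * Real.exp (t * η) := by
      have := Real.add_one_le_exp (-(t * η))
      have h3 : Real.exp (-(t*η)) * Real.exp (t*η) = 1 := by rw [← Real.exp_add]; simp
      nlinarith [Real.exp_pos (t * η)]
    have h2 : Real.exp (t * η) ≤ Real.exp t := Real.exp_le_exp.2 (by nlinarith)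
    have h4 : Real.exp φ ≤ 1 := Real.exp_le_one_iff.2 hφ
    have h5 : 0 ≤ Real.exp (t * η) - 1 := by linarith [Real.add_one_le_exp (t * η)]
    calc Real.exp (φ + t * η) - Real.exp φ = Real.exp φ * (Real.exp (t * η) - 1) := by
          rw [Real.exp_add]; ring
      _ ≤ 1 * (Real.exp (t * η) - 1) := mul_le_mul_of_nonneg_right h4 h5
      _ ≤ t * η * Real.exp (t * η) := by linarith
      _ ≤ t * η * Real.exp t := mul_le_mul_of_nonneg_left h2 hte
      _ = _ := by ring
  have hab : Real.exp φ ≤ Real.exp (φ + t * η) := Real.exp_le_exp.2 (by linarith)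
  set a := Real.exp (φ + t * η)
  set b := Real.exp φ with hb
  have hb0 : 0 < b := Real.exp_pos _
  have hbs : b ≤ Real.sqrt (b ^ 2 + p ^ 2) := Real.le_sqrt_of_sq_le (by nlinarith [sq_nonneg p])
  have : Real.sqrt (a ^ 2 + p ^ 2) ≤ Real.sqrt (b ^ 2 + p ^ 2) + (a - b) := by
    apply Real.sqrt_le_iff.2
    refine ⟨by linarith, ?_⟩
    have h6 : Real.sqrt (b ^ 2 + p ^ 2) ^ 2 = b ^ 2 + p ^ 2 := Real.sq_sqrt (by positivity)
    nlinarith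
  linarith

lemma weak_EL (k M J : ℝ) (f₀ : E3 → E3 → ℝ) (φ₀ : E3 → ℝ)
    (hadm : Admissible k M J f₀ φ₀)
    (hmin : energy f₀ φ₀ = energyInf k M J) (hEtop : energy f₀ φ₀ ≠ ⊤)
    (hsupp : ∀ᵐ z : E3 × E3, 0 < φ₀ z.1 → f₀ z.1 z.2 = 0)
    (η : E3 → ℝ) (hη : ContDiff ℝ 1 η) (hηc : HasCompactSupport η) (hη0 : ∀ x, 0 ≤ η x)
    (hη1 : ∀ x, η x ≤ 1) :
    - ∫ x, inner ℝ (gradient φ₀ x) (gradient η x) ≤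
      (∫⁻ z : E3 × E3, ENNReal.ofReal (η z.1 * f₀ z.1 z.2)).toReal := by
  obtain ⟨⟨hmeas, hpos, hmass, hLq⟩, ⟨hC, hG, hvan⟩, hfin⟩ := hadm
  have hmeas' : Measurable (fun z : E3 × E3 => f₀ z.1 z.2) := hmeas
  have hφc : Measurable φ₀ := hC.continuous.measurable
  have hηm : Measurable η := hη.continuous.measurable
  have cφ := cont_gradient φ₀ hC
  have cη := cont_gradient η hη
  have hgηc : HasCompactSupport (gradient η) := by
    unfold gradient
    exact (hηc.fderiv ℝ).comp_left (g := (InnerProductSpace.toDual ℝ E3).symm) (by simp)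
  set L := ∫ x, inner ℝ (gradient φ₀ x) (gradient η x) with hL
  set X := ∫⁻ z : E3 × E3, ENNReal.ofReal (η z.1 * f₀ z.1 z.2) with hX
  have hXtop : X ≠ ⊤ := by
    have : X ≤ ENNReal.ofReal M := by
      rw [← hmass]
      apply lintegral_mono_ae
      filter_upwards [hpos] with z hz
      exact ENNReal.ofReal_le_ofReal (mul_le_of_le_one_left hz (hη1 _))
    exact (this.trans_lt (by simp)).ne
  have iφ : Integrable (fun x => ‖gradient φ₀ x‖ ^ 2) := by
    refine ⟨(by fun_prop : Continuous (fun x => ‖gradient φ₀ x‖ ^ 2)).aestronglyMeasurable, ?_⟩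
    rw [hasFiniteIntegral_iff_ofReal (Eventually.of_forall fun x => by positivity)]
    exact hG
  have iL : Integrable (fun x => inner ℝ (gradient φ₀ x) (gradient η x)) := by
    apply Continuous.integrable_of_hasCompactSupport (by fun_prop)
    apply hgηc.mono
    intro x hx hx0
    apply hx
    simp [hx0]
  have iN : Integrable (fun x => ‖gradient η x‖ ^ 2) := by
    apply Continuous.integrable_of_hasCompactSupport (by fun_prop)
    apply hgηc.mono
    intro x hx hx0
    apply hx
    simp [hx0]
  set N := ∫ x, ‖gradient η x‖ ^ 2 with hN
  set G := ∫ x, ‖gradient φ₀ x‖ ^ 2 with hGdef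
  have hGl : (∫⁻ x : E3, ENNReal.ofReal (‖gradient φ₀ x‖ ^ 2)) = ENNReal.ofReal G :=
    (ofReal_integral_eq_lintegral_ofReal iφ (Eventually.of_forall fun x => by positivity)).symm
  have hG0 : 0 ≤ G := integral_nonneg fun x => by positivity
  have main : ∀ t : ℝ, 0 < t → 0 ≤ L + t * N / 2 + Real.exp t * X.toReal := by
    intro t ht
    have iGt : Integrable (fun x => ‖gradient (fun y => φ₀ y + t * η y) x‖ ^ 2) ∧
        ∫ x, ‖gradient (fun y => φ₀ y + t * η y) x‖ ^ 2 = G + 2 * t * L + t ^ 2 * N := by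
      have e : (fun x => ‖gradient (fun y => φ₀ y + t * η y) x‖ ^ 2) =
          fun x => ‖gradient φ₀ x‖ ^ 2 + (2 * t) * inner ℝ (gradient φ₀ x) (gradient η x)
            + t ^ 2 * ‖gradient η x‖ ^ 2 := by
        funext x
        rw [gradient_add_smul φ₀ η hC hη, norm_add_sq_real, inner_smul_right, norm_smul, mul_pow]
        simp
        ring
      rw [e]
      have i2 : Integrable (fun x => ‖gradient φ₀ x‖ ^ 2 + (2 * t) * inner ℝ (gradient φ₀ x) (gradient η x)) :=
        iφ.add (iL.const_mul _)
      refine ⟨i2.add (iN.const_mul _), ?_⟩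
      rw [integral_add i2 (iN.const_mul _), integral_add iφ (iL.const_mul _),
        integral_const_mul, integral_const_mul]
    obtain ⟨iGt, eGt⟩ := iGt
    set Gt := G + 2 * t * L + t ^ 2 * N with hGt
    have hGt0 : 0 ≤ Gt := eGt ▸ integral_nonneg fun x => by positivity
    have hGtl : (∫⁻ x : E3, ENNReal.ofReal (‖gradient (fun y => φ₀ y + t * η y) x‖ ^ 2)) = ENNReal.ofReal Gt := by
      rw [← eGt]
      exact (ofReal_integral_eq_lintegral_ofReal iGt (Eventually.of_forall fun x => by positivity)).symm
    have hadm : Admissible k M J f₀ (fun y => φ₀ y + t * η y) := by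
      refine ⟨⟨hmeas, hpos, hmass, hLq⟩, ⟨hC.add (contDiff_const.mul hη), ?_, ?_⟩, hfin⟩
      · rw [hGtl]; simp
      · intro a ha
        have hsub : {x : E3 | a < |φ₀ x + t * η x|} ⊆ {x | a < |φ₀ x|} ∪ tsupport η := by
          intro x hx
          by_cases hx2 : x ∈ tsupport η
          · exact Or.inr hx2
          · left
            have := image_eq_zero_of_notMem_tsupport hx2
            simpa [this] using hx
        exact (measure_mono hsub).trans_lt ((measure_union_le _ _).trans_lt
          (ENNReal.add_lt_top.2 ⟨hvan a ha, hηc.isCompact.measure_lt_top⟩))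
    have hle : energy f₀ φ₀ ≤ energy f₀ (fun y => φ₀ y + t * η y) := by
      rw [hmin]; exact sInf_le ⟨_, _, hadm, rfl⟩
    have hkin : kinE f₀ (fun y => φ₀ y + t * η y) ≤ kinE f₀ φ₀ + ENNReal.ofReal (t * Real.exp t) * X := by
      unfold kinE
      rw [hX, ← lintegral_const_mul' _ _ (by simp), ← lintegral_add_left (by fun_prop)]
      apply lintegral_mono_ae
      filter_upwards [hpos, hsupp] with z hz hz2
      rcases le_or_gt (φ₀ z.1) 0 with h | h
      · rw [← ENNReal.ofReal_mul (by positivity), ← ENNReal.ofReal_add (by positivity)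
          (mul_nonneg (by positivity) (mul_nonneg (hη0 _) hz))]
        apply ENNReal.ofReal_le_ofReal
        have := mul_le_mul_of_nonneg_right (sqrt_pert (φ₀ z.1) ‖z.2‖ t (η z.1) ht.le (hη0 _) (hη1 _) h) hz
        linarith
      · simp [hz2 h]
    have hktop : kinE f₀ φ₀ ≠ ⊤ := fun hcon => hEtop (by unfold energy; rw [hcon]; simp)
    have h1 : energy f₀ φ₀ ≤ kinE f₀ φ₀ + (ENNReal.ofReal (t * Real.exp t) * X + ENNReal.ofReal Gt / 2) := by
      refine hle.trans ?_
      rw [← add_assoc]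
      unfold energy
      rw [hGtl]
      gcongr
    unfold energy at h1
    rw [hGl] at h1
    have h2 := (ENNReal.add_le_add_iff_left hktop).1 h1
    have hX2 : ENNReal.ofReal (t * Real.exp t) * X ≠ ⊤ := ENNReal.mul_ne_top (by simp) hXtop
    have hGt2 : ENNReal.ofReal Gt / 2 ≠ ⊤ := ENNReal.div_ne_top (by simp) (by simp)
    have h3 := ENNReal.toReal_mono (ENNReal.add_ne_top.2 ⟨hX2, hGt2⟩) h2
    rw [ENNReal.toReal_add hX2 hGt2, ENNReal.toReal_div, ENNReal.toReal_div, ENNReal.toReal_mul,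
      ENNReal.toReal_ofReal hG0, ENNReal.toReal_ofReal hGt0, ENNReal.toReal_ofReal (by positivity)] at h3
    simp only [ENNReal.toReal_ofNat] at h3
    have h4 : 0 ≤ t * (L + t * N / 2 + Real.exp t * X.toReal) := by
      rw [hGt] at h3
      linarith
    exact nonneg_of_mul_nonneg_right h4 ht
  have hlim : Tendsto (fun t : ℝ => L + t * N / 2 + Real.exp t * X.toReal) (𝓝[>] 0)
      (𝓝 (L + 0 * N / 2 + Real.exp 0 * X.toReal)) := by
    apply Tendsto.mono_left _ nhdsWithin_le_nhds
    apply Continuous.tendsto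
    fun_prop
  have := ge_of_tendsto hlim (by filter_upwards [self_mem_nhdsWithin] with t ht using main t ht)
  simp at this
  linarith

def omg (y : E3) : ℝ := max 0 (1 - ‖y‖ ^ 2)

def tst (x₀ : E3) (r : ℝ) (x : E3) : ℝ := omg (r⁻¹ • (x - x₀)) ^ 2 / 4

lemma omg_cont : Continuous omg := by unfold omg; fun_prop

lemma omg_nonneg (y : E3) : 0 ≤ omg y := le_max_left _ _

lemma omg_le_one (y : E3) : omg y ≤ 1 := max_le zero_le_one (by nlinarith [sq_nonneg ‖y‖])

lemma omg_zero {y : E3} (hy : 1 ≤ ‖y‖) : omg y = 0 := max_eq_left (by nlinarith)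

lemma omg_supp : HasCompactSupport omg := by
  apply HasCompactSupport.intro (isCompact_closedBall (0 : E3) 1)
  intro y hy
  apply omg_zero
  simp at hy
  exact hy.le

lemma hasDerivAt_maxsq (s : ℝ) : HasDerivAt (fun t : ℝ => max 0 t ^ 2) (2 * max 0 s) s := by
  rcases lt_trichotomy s 0 with h | h | h
  · have : HasDerivAt (fun _ : ℝ => (0 : ℝ)) 0 s := hasDerivAt_const _ _
    rw [max_eq_left h.le, mul_zero]
    refine this.congr_of_eventuallyEq ?_
    filter_upwards [gt_mem_nhds h] with t ht
    simp [max_eq_left ht.le]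
  · subst h
    simp only [max_self, mul_zero]
    rw [hasDerivAt_iff_isLittleO]
    simp only [max_self, sub_zero, smul_zero]
    have : (fun t : ℝ => max 0 t ^ 2 - 0 ^ 2) =O[𝓝 0] fun t : ℝ => t ^ 2 := by
      apply Asymptotics.IsBigO.of_bound 1
      filter_upwards with t
      rcases le_total t 0 with h | h
      · simp [max_eq_left h]; positivity
      · simp [max_eq_right h]
    refine this.trans_isLittleO ?_
    have := Asymptotics.isLittleO_pow_id (𝕜 := ℝ) (n := 2) (by norm_num)
    simpa using this
  · have : HasDerivAt (fun t : ℝ => t ^ 2) (2 * s) s := by simpa using hasDerivAt_pow 2 s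
    rw [max_eq_right h.le]
    refine this.congr_of_eventuallyEq ?_
    filter_upwards [lt_mem_nhds h] with t ht
    simp [max_eq_right ht.le]

lemma contDiff_maxsq : ContDiff ℝ 1 (fun t : ℝ => max 0 t ^ 2) := by
  rw [contDiff_one_iff_deriv]
  refine ⟨fun s => (hasDerivAt_maxsq s).differentiableAt, ?_⟩
  have : deriv (fun t : ℝ => max 0 t ^ 2) = fun s => 2 * max 0 s := funext fun s => (hasDerivAt_maxsq s).deriv
  rw [this]
  fun_prop

lemma tst_contDiff (x₀ : E3) (r : ℝ) : ContDiff ℝ 1 (tst x₀ r) := by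
  have h : ContDiff ℝ 1 (fun x : E3 => 1 - ‖r⁻¹ • (x - x₀)‖ ^ 2) := by
    apply contDiff_const.sub
    apply ContDiff.norm_sq ℝ
    fun_prop
  exact (contDiff_maxsq.comp h).div_const 4

lemma tst_gradient (x₀ : E3) (r : ℝ) (x : E3) :
    gradient (tst x₀ r) x = -((r⁻¹ * omg (r⁻¹ • (x - x₀))) • (r⁻¹ • (x - x₀))) := by
  apply HasGradientAt.gradient
  rw [hasGradientAt_iff_hasFDerivAt]
  have h0 : HasFDerivAt (fun x : E3 => r⁻¹ • (x - x₀)) (r⁻¹ • ContinuousLinearMap.id ℝ E3) x :=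
    ((hasFDerivAt_id x).sub_const x₀).const_smul r⁻¹
  have h1 := (h0.norm_sq).const_sub 1
  have h2 := ((hasDerivAt_maxsq (1 - ‖r⁻¹ • (x - x₀)‖ ^ 2)).comp_hasFDerivAt x h1).mul_const (4 : ℝ)⁻¹
  refine HasFDerivAt.congr_fderiv (f := tst x₀ r) (h2.congr_of_eventuallyEq ?_) ?_
  · exact Eventually.of_forall fun y => by simp [tst, omg, div_eq_mul_inv]
  · apply ContinuousLinearMap.ext
    intro v
    rw [InnerProductSpace.toDual_apply_apply]
    simp [omg, inner_smul_left, inner_sub_left]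
    ring

lemma tst_nonneg (x₀ : E3) (r : ℝ) (x : E3) : 0 ≤ tst x₀ r x := by unfold tst; positivity

lemma tst_le_one (x₀ : E3) (r : ℝ) (x : E3) : tst x₀ r x ≤ 1 := by
  unfold tst
  have h1 := omg_nonneg (r⁻¹ • (x - x₀))
  have h2 := omg_le_one (r⁻¹ • (x - x₀))
  nlinarith

lemma tst_zero (x₀ : E3) (r : ℝ) (hr : 0 < r) (x : E3) (hx : x ∉ Metric.closedBall x₀ r) : tst x₀ r x = 0 := by
  unfold tst
  rw [omg_zero]
  · simp
  · rw [norm_smul, norm_inv, Real.norm_of_nonneg hr.le, inv_mul_eq_div, le_div_iff₀ hr]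
    simp [dist_eq_norm] at hx
    linarith

lemma tst_supp (x₀ : E3) (r : ℝ) (hr : 0 < r) : HasCompactSupport (tst x₀ r) :=
  HasCompactSupport.intro (isCompact_closedBall x₀ r) fun x hx => tst_zero x₀ r hr x hx

lemma flux_eq (φ : E3 → ℝ) (x₀ : E3) (r : ℝ) (hr : 0 < r) :
    ∫ y, omg y * inner ℝ (gradient φ (x₀ + r • y)) y =
      (r ^ 2)⁻¹ * (- ∫ x, inner ℝ (gradient φ x) (gradient (tst x₀ r) x)) := by
  set F : E3 → ℝ := fun x => omg (r⁻¹ • (x - x₀)) * inner ℝ (gradient φ x) (r⁻¹ • (x - x₀)) with hF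
  have h1 : ∫ y, omg y * inner ℝ (gradient φ (x₀ + r • y)) y = ∫ y, F (x₀ + r • y) := by
    congr 1
    funext y
    simp only [hF]
    rw [add_sub_cancel_left, inv_smul_smul₀ hr.ne']
  have h2 : ∫ y, F (x₀ + r • y) = (r ^ 3)⁻¹ * ∫ x, F x := by
    have := Measure.integral_comp_smul_of_nonneg (volume : Measure E3) (fun y => F (x₀ + y)) r (hR := hr.le)
    rw [this, integral_add_left_eq_self]
    simp
  have h3 : (- ∫ x, inner ℝ (gradient φ x) (gradient (tst x₀ r) x)) = r⁻¹ * ∫ x, F x := by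
    rw [← integral_neg, ← integral_const_mul]
    congr 1
    funext x
    rw [tst_gradient, inner_neg_right, neg_neg, inner_smul_right, mul_assoc]
  rw [h1, h2, h3]
  field_simp

lemma avg_hasDerivAt (φ : E3 → ℝ) (hφ : ContDiff ℝ 1 φ) (x₀ : E3) (r : ℝ) (hr0 : 0 ≤ r) (hr1 : r ≤ 1) :
    HasDerivAt (fun r : ℝ => ∫ y, omg y * φ (x₀ + r • y))
      (∫ y, omg y * inner ℝ (gradient φ (x₀ + r • y)) y) r := by
  have cφ := cont_gradient φ hφ
  have cφ0 := hφ.continuous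
  have co := omg_cont
  obtain ⟨C, hC⟩ := (isCompact_closedBall x₀ (2:ℝ)).exists_bound_of_continuousOn cφ.continuousOn
  have hC0 : 0 ≤ C := (norm_nonneg _).trans (hC x₀ (by simp))
  refine (hasDerivAt_integral_of_dominated_loc_of_deriv_le (μ := volume)
    (F := fun (r : ℝ) y => omg y * φ (x₀ + r • y))
    (F' := fun (r : ℝ) y => omg y * inner ℝ (gradient φ (x₀ + r • y)) y)
    (bound := fun y => omg y * C) (Metric.ball_mem_nhds r one_pos) ?_ ?_ ?_ ?_ ?_ ?_).2
  · exact Eventually.of_forall fun s => Continuous.aestronglyMeasurable (by fun_prop)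
  · apply Continuous.integrable_of_hasCompactSupport (by fun_prop)
    exact omg_supp.mul_right
  · exact Continuous.aestronglyMeasurable (by fun_prop)
  · refine Eventually.of_forall fun y s hs => ?_
    rw [norm_mul, Real.norm_of_nonneg (omg_nonneg y)]
    rcases le_total 1 ‖y‖ with hy | hy
    · simp [omg_zero hy]
    · apply mul_le_mul_of_nonneg_left _ (omg_nonneg y)
      have hs2 : |s| ≤ 2 := by
        rw [Metric.mem_ball, Real.dist_eq, abs_lt] at hs
        rw [abs_le]
        constructor <;> linarith
      have hmem : x₀ + s • y ∈ Metric.closedBall x₀ 2 := by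
        simp only [Metric.mem_closedBall, dist_eq_norm, add_sub_cancel_left, norm_smul, Real.norm_eq_abs]
        nlinarith [norm_nonneg y, abs_nonneg s]
      refine (norm_inner_le_norm _ _).trans ?_
      have := hC _ hmem
      nlinarith [norm_nonneg y, norm_nonneg (gradient φ (x₀ + s • y))]
  · exact (co.integrable_of_hasCompactSupport omg_supp).mul_const C
  · refine Eventually.of_forall fun y s hs => ?_
    apply HasDerivAt.const_mul
    have h1 : HasFDerivAt φ (fderiv ℝ φ (x₀ + s • y)) (x₀ + s • y) :=
      (hφ.differentiable (by norm_num) _).hasFDerivAt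
    have h2 : HasDerivAt (fun s : ℝ => x₀ + s • y) y s := by
      simpa using ((hasDerivAt_id s).smul_const y).const_add x₀
    rw [inner_gradient_left]
    exact h1.comp_hasDerivAt s h2

lemma growth (φ : E3 → ℝ) (hφ : ContDiff ℝ 1 φ) (x₀ : E3) (D s : ℝ) (hs : 1 < s)
    (hD : ∀ r : ℝ, 0 < r → r < 1 →
      - ∫ x, inner ℝ (gradient φ x) (gradient (tst x₀ r) x) ≤ D * r ^ s) :
    (∫ y, omg y * φ (x₀ + y)) - φ x₀ * ∫ y, omg y ≤ D / (s - 1) := by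
  set A : ℝ → ℝ := fun r : ℝ => ∫ y, omg y * φ (x₀ + r • y) with hA
  set B : ℝ → ℝ := fun r => A r - D / (s - 1) * r ^ (s - 1) with hB
  have hanti : AntitoneOn B (Set.Icc 0 1) := by
    have hcA : ContinuousOn A (Set.Icc 0 1) := fun r hr =>
      (avg_hasDerivAt φ hφ x₀ r hr.1 hr.2).continuousAt.continuousWithinAt
    have hder : ∀ r ∈ Set.Ioo (0:ℝ) 1, HasDerivAt B
        ((∫ y, omg y * inner ℝ (gradient φ (x₀ + r • y)) y) - D / (s - 1) * ((s - 1) * r ^ (s - 1 - 1))) r := by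
      intro r hr
      exact (avg_hasDerivAt φ hφ x₀ r hr.1.le hr.2.le).sub
        ((Real.hasDerivAt_rpow_const (Or.inl hr.1.ne')).const_mul _)
    apply antitoneOn_of_deriv_nonpos (convex_Icc 0 1)
    · apply hcA.sub
      apply ContinuousOn.mul continuousOn_const
      exact (Real.continuous_rpow_const (by linarith)).continuousOn
    · rw [interior_Icc]
      exact fun r hr => (hder r hr).differentiableAt.differentiableWithinAt
    · rw [interior_Icc]
      intro r hr
      rw [(hder r hr).deriv, flux_eq φ x₀ r hr.1]
      have h1 := hD r hr.1 hr.2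
      have h2 : (r ^ 2)⁻¹ * (- ∫ x, inner ℝ (gradient φ x) (gradient (tst x₀ r) x)) ≤ (r ^ 2)⁻¹ * (D * r ^ s) :=
        mul_le_mul_of_nonneg_left h1 (by positivity)
      have h3 : D / (s - 1) * ((s - 1) * r ^ (s - 1 - 1)) = (r ^ 2)⁻¹ * (D * r ^ s) := by
        have : s - 1 - 1 = s - (2 : ℕ) := by push_cast; ring
        rw [this, Real.rpow_sub_natCast hr.1.ne']
        have : s - 1 ≠ 0 := by linarith
        field_simp
      linarith
  have h := hanti (Set.left_mem_Icc.2 zero_le_one) (Set.right_mem_Icc.2 zero_le_one) zero_le_one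
  have e0 : A 0 = φ x₀ * ∫ y, omg y := by
    simp only [hA, zero_smul, add_zero]
    rw [integral_mul_const, mul_comm]
  have e1 : A 1 = ∫ y, omg y * φ (x₀ + y) := by simp [hA]
  simp only [hB, e0, e1, Real.one_rpow, Real.zero_rpow (by linarith : s - 1 ≠ 0)] at h
  linarith

lemma tail_small {α : Type*} [MeasurableSpace α] (μ : Measure α) (F : α → ℝ≥0∞)
    (hF : ∫⁻ z, F z ∂μ ≠ ⊤) (N : α → ℝ) (hN : Measurable N) (ε : ℝ≥0∞) (hε : 0 < ε) :
    ∃ R : ℝ, 0 < R ∧ ∫⁻ z in {z | R ≤ N z}, F z ∂μ ≤ ε := by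
  set ν := μ.withDensity F with hν
  have hmS : ∀ R : ℝ, MeasurableSet {z | R ≤ N z} := fun R => measurableSet_le measurable_const hN
  have hfin : ν Set.univ ≠ ⊤ := by
    rw [hν, withDensity_apply _ MeasurableSet.univ]
    simpa using hF
  have ht : Tendsto (fun n : ℕ => ν {z | (n : ℝ) ≤ N z}) atTop (𝓝 (ν (⋂ n : ℕ, {z | (n : ℝ) ≤ N z}))) := by
    apply tendsto_measure_iInter_atTop
    · exact fun n => (hmS n).nullMeasurableSet
    · intro m n hmn z hz
      have : (m : ℝ) ≤ n := by exact_mod_cast hmn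
      exact this.trans hz
    · exact ⟨0, ((measure_mono (Set.subset_univ _)).trans_lt hfin.lt_top).ne⟩
  have he : (⋂ n : ℕ, {z | (n : ℝ) ≤ N z}) = ∅ := by
    ext z
    simp only [Set.mem_iInter, Set.mem_ofPred_eq, Set.mem_empty_iff_false, iff_false, not_forall, not_le]
    exact exists_nat_gt (N z)
  rw [he, measure_empty] at ht
  obtain ⟨n, hn, hn1⟩ := ((ht.eventually (gt_mem_nhds hε)).and (eventually_ge_atTop 1)).exists
  refine ⟨n, by exact_mod_cast hn1, ?_⟩
  rw [← withDensity_apply _ (hmS n)]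
  exact hn.le

lemma grad_path (φ : E3 → ℝ) (hφ : ContDiff ℝ 1 φ) (x z : E3) (hz : ‖z‖ ≤ 1) :
    ‖φ (x + z) - φ x‖ₑ ≤ ∫⁻ t in Set.Icc (0:ℝ) 1, ‖gradient φ (x + t • z)‖ₑ := by
  have hd : ∀ t : ℝ, HasDerivAt (fun t : ℝ => φ (x + t • z)) (inner ℝ (gradient φ (x + t • z)) z) t := by
    intro s
    have h1 : HasFDerivAt φ (fderiv ℝ φ (x + s • z)) (x + s • z) :=
      (hφ.differentiable (by norm_num) _).hasFDerivAt
    have h2 : HasDerivAt (fun s : ℝ => x + s • z) z s := by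
      simpa using ((hasDerivAt_id s).smul_const z).const_add x
    rw [inner_gradient_left]
    exact h1.comp_hasDerivAt s h2
  have hcd : ContDiff ℝ 1 (fun t : ℝ => φ (x + t • z)) := by
    apply hφ.comp
    fun_prop
  have := enorm_sub_le_lintegral_deriv_of_contDiffOn_Icc (a := 0) (b := 1) hcd.contDiffOn zero_le_one
  simp only [one_smul, zero_smul, add_zero] at this
  refine this.trans (lintegral_mono fun t => ?_)
  rw [(hd t).deriv, ← ofReal_norm, ← ofReal_norm]
  apply ENNReal.ofReal_le_ofReal
  refine (norm_inner_le_norm _ _).trans ?_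
  exact mul_le_of_le_one_right (norm_nonneg _) hz

lemma poinc_local (φ : E3 → ℝ) (hφ : ContDiff ℝ 1 φ) (x₀ : E3) (a : ℝ)
    (hN : ∀ x ∈ Metric.closedBall x₀ 1, volume ({z : E3 | a < |φ (x + z)|} ∩ Metric.closedBall (0 : E3) 1)
      ≤ volume (Metric.closedBall (0 : E3) 1) / 2) :
    ∫⁻ x in Metric.closedBall x₀ 1, ‖φ x‖ₑ ≤
      2 * (ENNReal.ofReal a * volume (Metric.closedBall (0 : E3) 1)
        + ∫⁻ x in Metric.closedBall x₀ 2, ‖gradient φ x‖ₑ) := by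
  have cφ := cont_gradient φ hφ
  have c0 := hφ.continuous
  set Z := Metric.closedBall (0 : E3) 1 with hZ
  set B := Metric.closedBall x₀ 1 with hB
  set v := volume Z with hv
  set Q := ∫⁻ x in Metric.closedBall x₀ 2, ‖gradient φ x‖ₑ with hQ
  have hZm : MeasurableSet Z := Metric.isClosed_closedBall.measurableSet
  have hBm : MeasurableSet B := Metric.isClosed_closedBall.measurableSet
  have hvt : v ≠ ⊤ := (isCompact_closedBall (0:E3) 1).measure_lt_top.ne
  have hv0 : v ≠ 0 := (Metric.measure_closedBall_pos volume (0:E3) one_pos).ne'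
  have hvB : volume B = v := by
    rw [hB, hv, hZ, Measure.addHaar_closedBall_center]
  have hD : ∫⁻ x in B, ∫⁻ z in Z, ‖φ (x + z) - φ x‖ₑ ≤ v * Q := by
    rw [lintegral_lintegral_swap (Continuous.aemeasurable (by fun_prop))]
    calc ∫⁻ z in Z, ∫⁻ x in B, ‖φ (x + z) - φ x‖ₑ ≤ ∫⁻ z in Z, Q := by
          apply setLIntegral_mono' hZm
          intro z hz
          have hz1 : ‖z‖ ≤ 1 := by simpa [hZ] using hz
          calc ∫⁻ x in B, ‖φ (x + z) - φ x‖ₑ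
              ≤ ∫⁻ x in B, ∫⁻ t in Set.Icc (0:ℝ) 1, ‖gradient φ (x + t • z)‖ₑ :=
                lintegral_mono fun x => grad_path φ hφ x z hz1
            _ = ∫⁻ t in Set.Icc (0:ℝ) 1, ∫⁻ x in B, ‖gradient φ (x + t • z)‖ₑ :=
                lintegral_lintegral_swap (Continuous.aemeasurable (by fun_prop))
            _ ≤ ∫⁻ t in Set.Icc (0:ℝ) 1, Q := by
                apply setLIntegral_mono' measurableSet_Icc
                intro t ht
                rw [hQ, ← lintegral_indicator hBm, ← lintegral_indicator Metric.isClosed_closedBall.measurableSet]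
                rw [← lintegral_add_right_eq_self ((Metric.closedBall x₀ 2).indicator (fun x => ‖gradient φ x‖ₑ)) (t • z)]
                apply lintegral_mono
                intro x
                dsimp only
                by_cases hx : x ∈ B
                · have : x + t • z ∈ Metric.closedBall x₀ 2 := by
                    have h1 : ‖x - x₀‖ ≤ 1 := by simpa [hB, dist_eq_norm] using hx
                    simp only [Metric.mem_closedBall, dist_eq_norm]
                    have h2 : ‖t • z‖ ≤ 1 := by
                      rw [norm_smul, Real.norm_of_nonneg ht.1]
                      exact mul_le_one₀ ht.2 (norm_nonneg _) hz1
                    calc ‖x + t • z - x₀‖ = ‖(x - x₀) + t • z‖ := by congr 1; abel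
                      _ ≤ ‖x - x₀‖ + ‖t • z‖ := norm_add_le _ _
                      _ ≤ 2 := by linarith
                  rw [Set.indicator_of_mem hx, Set.indicator_of_mem this]
                · rw [Set.indicator_of_notMem hx]
                  exact zero_le
            _ = Q := by simp
      _ = v * Q := by simp [hv, mul_comm]
  have hpt : ∀ x ∈ B, v / 2 * ‖φ x‖ₑ ≤ ENNReal.ofReal a * v + ∫⁻ z in Z, ‖φ (x + z) - φ x‖ₑ := by
    intro x hx
    set S : Set E3 := {z : E3 | a < |φ (x + z)|} with hS
    have hSm : MeasurableSet S := measurableSet_lt measurable_const (by fun_prop)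
    have h1 : ∫⁻ z in Z, ‖φ x‖ₑ ≤ ∫⁻ z in Z, (ENNReal.ofReal a + ‖φ (x + z) - φ x‖ₑ + S.indicator (fun _ => ‖φ x‖ₑ) z) := by
      apply lintegral_mono
      intro z
      dsimp only
      by_cases hz : z ∈ S
      · rw [Set.indicator_of_mem hz]
        exact le_add_self
      · rw [Set.indicator_of_notMem hz, add_zero]
        have h2 : |φ (x + z)| ≤ a := not_lt.1 hz
        have h0 : 0 ≤ a := (abs_nonneg _).trans h2
        rw [← ofReal_norm, ← ofReal_norm, ← ENNReal.ofReal_add h0 (norm_nonneg _)]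
        apply ENNReal.ofReal_le_ofReal
        have h3 : ‖φ x‖ ≤ ‖φ (x + z)‖ + ‖φ (x + z) - φ x‖ := by
          calc ‖φ x‖ = ‖φ (x + z) - (φ (x + z) - φ x)‖ := by congr 1; ring
            _ ≤ _ := norm_sub_le _ _
        rw [Real.norm_eq_abs (φ (x + z))] at h3
        linarith
    rw [lintegral_add_right _ (measurable_const.indicator hSm), lintegral_add_left measurable_const,
      lintegral_indicator hSm, setLIntegral_const, setLIntegral_const, setLIntegral_const,
      Measure.restrict_apply hSm] at h1
    have h4 : ‖φ x‖ₑ * volume (S ∩ Z) ≤ ‖φ x‖ₑ * (v / 2) := by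
      gcongr
      exact hN x hx
    have h5 : v / 2 * ‖φ x‖ₑ + v / 2 * ‖φ x‖ₑ ≤
        (ENNReal.ofReal a * v + ∫⁻ z in Z, ‖φ (x + z) - φ x‖ₑ) + v / 2 * ‖φ x‖ₑ := by
      rw [← add_mul, ENNReal.add_halves, mul_comm v]
      refine h1.trans ?_
      rw [mul_comm (v / 2)]
      gcongr
    exact (ENNReal.add_le_add_iff_right (ENNReal.mul_ne_top (ENNReal.div_ne_top hvt (by simp)) (by simp))).1 h5
  have h6 : v / 2 * ∫⁻ x in B, ‖φ x‖ₑ ≤ v * (ENNReal.ofReal a * v + Q) := by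
    rw [← lintegral_const_mul' _ _ (ENNReal.div_ne_top hvt (by simp))]
    refine (setLIntegral_mono' hBm hpt).trans ?_
    rw [lintegral_add_left measurable_const, setLIntegral_const, hvB, mul_add]
    rw [mul_comm v (ENNReal.ofReal a * v)]
    gcongr
  have h7 : v * ∫⁻ x in B, ‖φ x‖ₑ ≤ v * (2 * (ENNReal.ofReal a * v + Q)) := by
    calc v * ∫⁻ x in B, ‖φ x‖ₑ = 2 * (v / 2 * ∫⁻ x in B, ‖φ x‖ₑ) := by
          rw [← mul_assoc, ENNReal.mul_div_cancel (by simp) (by simp)]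
      _ ≤ 2 * (v * (ENNReal.ofReal a * v + Q)) := by gcongr
      _ = _ := by ring
  exact (ENNReal.mul_le_mul_iff_right hv0 hvt).1 h7

lemma poinc_tail (φ : E3 → ℝ) (hφ : IsPotential φ) (δ : ℝ) (hδ : 0 < δ) :
    ∃ R : ℝ, 0 < R ∧ ∀ x₀ : E3, R ≤ ‖x₀‖ →
      ∫⁻ x in Metric.closedBall x₀ 1, ‖φ x‖ₑ ≤ ENNReal.ofReal δ := by
  obtain ⟨hC, hG, hvan⟩ := hφ
  have cφ := cont_gradient φ hC
  have c0 := hC.continuous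
  set v := volume (Metric.closedBall (0 : E3) 1) with hv
  have hvt : v ≠ ⊤ := (isCompact_closedBall (0:E3) 1).measure_lt_top.ne
  have hv0 : v ≠ 0 := (Metric.measure_closedBall_pos volume (0:E3) one_pos).ne'
  set w := v.toReal with hw
  have hw0 : 0 < w := ENNReal.toReal_pos hv0 hvt
  have hvw : v = ENNReal.ofReal w := (ENNReal.ofReal_toReal hvt).symm
  set a := δ / (6 * w) with ha
  have ha0 : 0 < a := by positivity
  set b := δ / (48 * w) with hb
  have hb0 : 0 < b := by positivity
  have hNm : MeasurableSet {x : E3 | a < |φ x|} := measurableSet_lt measurable_const (by fun_prop)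
  obtain ⟨R1, hR1, hT1⟩ := tail_small (volume : Measure E3) ({x : E3 | a < |φ x|}.indicator (fun _ => 1))
    (by rw [lintegral_indicator hNm, setLIntegral_const, one_mul]; exact (hvan a ha0).ne)
    (fun x => ‖x‖) measurable_norm (v / 2) (ENNReal.half_pos hv0)
  obtain ⟨R2, hR2, hT2⟩ := tail_small (volume : Measure E3) (fun x => ENNReal.ofReal (‖gradient φ x‖ ^ 2)) hG.ne
    (fun x => ‖x‖) measurable_norm (ENNReal.ofReal (b * (δ / 6))) (by simp; positivity)
  rw [lintegral_indicator hNm, setLIntegral_const, one_mul, Measure.restrict_apply hNm] at hT1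
  refine ⟨R1 + R2 + 2, by positivity, fun x₀ hx₀ => ?_⟩
  have hfar : ∀ x ∈ Metric.closedBall x₀ 2, R1 ≤ ‖x‖ ∧ R2 ≤ ‖x‖ := by
    intro x hx
    have h1 : ‖x - x₀‖ ≤ 2 := by simpa [dist_eq_norm] using hx
    have h2 : ‖x₀‖ ≤ ‖x‖ + ‖x - x₀‖ := by
      calc ‖x₀‖ = ‖x - (x - x₀)‖ := by congr 1; abel
        _ ≤ _ := norm_sub_le _ _
    constructor <;> linarith
  refine (poinc_local φ hC x₀ a ?_).trans ?_
  · intro x hx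
    refine le_trans ?_ hT1
    rw [← measure_preimage_add volume x ({x | a < |φ x|} ∩ {z | R1 ≤ ‖z‖})]
    apply measure_mono
    rintro z ⟨hz1, hz2⟩
    refine ⟨hz1, (hfar (x + z) ?_).1⟩
    have h1 : ‖x - x₀‖ ≤ 1 := by simpa [dist_eq_norm] using hx
    have h2 : ‖z‖ ≤ 1 := by simpa using hz2
    simp only [Metric.mem_closedBall, dist_eq_norm]
    calc ‖x + z - x₀‖ = ‖(x - x₀) + z‖ := by congr 1; abel
      _ ≤ ‖x - x₀‖ + ‖z‖ := norm_add_le _ _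
      _ ≤ 2 := by linarith
  · have hQ : ∫⁻ x in Metric.closedBall x₀ 2, ‖gradient φ x‖ₑ ≤ ENNReal.ofReal (δ / 3) := by
      calc ∫⁻ x in Metric.closedBall x₀ 2, ‖gradient φ x‖ₑ
          ≤ ∫⁻ x in Metric.closedBall x₀ 2, (ENNReal.ofReal b + ENNReal.ofReal b⁻¹ * ENNReal.ofReal (‖gradient φ x‖ ^ 2)) := by
            apply lintegral_mono
            intro x
            dsimp only
            rw [← ENNReal.ofReal_mul (by positivity), ← ENNReal.ofReal_add (by positivity) (by positivity), ← ofReal_norm]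
            apply ENNReal.ofReal_le_ofReal
            have hn := norm_nonneg (gradient φ x)
            have : b⁻¹ * ‖gradient φ x‖ ^ 2 + b - ‖gradient φ x‖ = b⁻¹ * ((‖gradient φ x‖ - b / 2) ^ 2 + 3 / 4 * b ^ 2) := by
              field_simp
              ring
            have h2 : 0 ≤ b⁻¹ * ((‖gradient φ x‖ - b / 2) ^ 2 + 3 / 4 * b ^ 2) := by positivity
            linarith
        _ = ENNReal.ofReal b * volume (Metric.closedBall x₀ 2) +
            ENNReal.ofReal b⁻¹ * ∫⁻ x in Metric.closedBall x₀ 2, ENNReal.ofReal (‖gradient φ x‖ ^ 2) := by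
            rw [lintegral_add_left measurable_const, setLIntegral_const, lintegral_const_mul' _ _ (by simp)]
        _ ≤ ENNReal.ofReal b * ENNReal.ofReal (8 * w) + ENNReal.ofReal b⁻¹ * ENNReal.ofReal (b * (δ / 6)) := by
            gcongr
            · rw [Measure.addHaar_closedBall' volume x₀ (by norm_num), ← hv, hvw, ← ENNReal.ofReal_mul (by positivity)]
              apply ENNReal.ofReal_le_ofReal
              simp
              linarith
            · refine le_trans (lintegral_mono_set ?_) hT2
              exact fun x hx => (hfar x hx).2
        _ = ENNReal.ofReal (δ / 3) := by
            rw [← ENNReal.ofReal_mul (by positivity), ← ENNReal.ofReal_mul (by positivity), ← ENNReal.ofReal_add (by positivity) (by positivity)]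
            congr 1
            rw [hb]
            field_simp
            ring
    calc 2 * (ENNReal.ofReal a * v + ∫⁻ x in Metric.closedBall x₀ 2, ‖gradient φ x‖ₑ)
        ≤ ENNReal.ofReal 2 * (ENNReal.ofReal a * ENNReal.ofReal w + ENNReal.ofReal (δ / 3)) := by
          rw [hvw]
          simp only [ENNReal.ofReal_ofNat]
          gcongr
      _ = ENNReal.ofReal δ := by
          rw [← ENNReal.ofReal_mul (by positivity), ← ENNReal.ofReal_add (by positivity) (by positivity), ← ENNReal.ofReal_mul (by positivity)]
          congr 1
          rw [ha]
          field_simp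
          ring

lemma holder_bound (k : ℝ) (hk : 0 < k) (f₀ : E3 → E3 → ℝ)
    (hmeas : Measurable (fun z : E3 × E3 => f₀ z.1 z.2))
    (hp : ∀ᵐ z : E3 × E3, 1 ≤ ‖z.2‖ → f₀ z.1 z.2 = 0)
    (x₀ : E3) (r : ℝ) (hr : 0 < r) (hr1 : r < 1)
    (η : E3 → ℝ) (hη0 : ∀ x, 0 ≤ η x) (hη1 : ∀ x, η x ≤ 1)
    (hηs : ∀ x, x ∉ Metric.closedBall x₀ r → η x = 0) (ε : ℝ) (hε : 0 ≤ ε)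
    (hT : ∫⁻ z in (Metric.closedBall x₀ 1) ×ˢ (Set.univ : Set E3), ‖f₀ z.1 z.2‖ₑ ^ (1 + 1 / k)
      ≤ ENNReal.ofReal (ε ^ (1 + 1 / k))) :
    (∫⁻ z : E3 × E3, ENNReal.ofReal (η z.1 * f₀ z.1 z.2)).toReal ≤
      ε * ((volume (Metric.closedBall (0 : E3) 1)).toReal ^ 2) ^ (1 / (1 + k)) * r ^ (3 / (1 + k)) := by
  set v := volume (Metric.closedBall (0 : E3) 1) with hv
  have hvt : v ≠ ⊤ := (isCompact_closedBall (0:E3) 1).measure_lt_top.ne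
  set w := v.toReal with hw
  have hw0 : 0 ≤ w := ENNReal.toReal_nonneg
  have hvw : v = ENNReal.ofReal w := (ENNReal.ofReal_toReal hvt).symm
  set p : ℝ := 1 + 1 / k with hpdef
  set q : ℝ := 1 + k with hqdef
  have hp0 : 0 < p := by positivity
  have hq0 : 0 < q := by positivity
  have hpq : p.HolderConjugate q := by
    rw [Real.holderConjugate_iff]
    constructor
    · have : 0 < 1 / k := by positivity
      linarith
    · rw [hpdef, hqdef]; field_simp; ring
  set S : Set (E3 × E3) := (Metric.closedBall x₀ 1) ×ˢ (Set.univ : Set E3) with hS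
  have hSm : MeasurableSet S := Metric.isClosed_closedBall.measurableSet.prod MeasurableSet.univ
  set U : Set (E3 × E3) := (Metric.closedBall x₀ r) ×ˢ (Metric.closedBall (0 : E3) 1) with hU
  have hUm : MeasurableSet U := Metric.isClosed_closedBall.measurableSet.prod Metric.isClosed_closedBall.measurableSet
  set F : E3 × E3 → ℝ≥0∞ := S.indicator (fun z => ‖f₀ z.1 z.2‖ₑ) with hF
  set g : E3 × E3 → ℝ≥0∞ := U.indicator (fun _ => 1) with hg
  have hFm : Measurable F := (by fun_prop : Measurable (fun z : E3 × E3 => ‖f₀ z.1 z.2‖ₑ)).indicator hSm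
  have hgm : Measurable g := measurable_const.indicator hUm
  have h1 : ∫⁻ z : E3 × E3, ENNReal.ofReal (η z.1 * f₀ z.1 z.2) ≤ ∫⁻ z, (F * g) z := by
    apply lintegral_mono_ae
    filter_upwards [hp] with z hz
    by_cases hz1 : z.1 ∈ Metric.closedBall x₀ r
    · by_cases hz2 : z.2 ∈ Metric.closedBall (0 : E3) 1
      · have hzU : z ∈ U := ⟨hz1, hz2⟩
        have hzS : z ∈ S := ⟨Metric.closedBall_subset_closedBall hr1.le hz1, Set.mem_univ _⟩
        simp only [Pi.mul_apply, hF, hg, Set.indicator_of_mem hzU, Set.indicator_of_mem hzS, mul_one]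
        rw [← ofReal_norm]
        apply ENNReal.ofReal_le_ofReal
        refine (le_abs_self _).trans ?_
        rw [abs_mul, abs_of_nonneg (hη0 _), Real.norm_eq_abs]
        exact mul_le_of_le_one_left (abs_nonneg _) (hη1 _)
      · have : 1 ≤ ‖z.2‖ := by
          simp at hz2
          exact hz2.le
        simp [hz this]
    · simp [hηs _ hz1]
  have h2 := ENNReal.lintegral_mul_le_Lp_mul_Lq volume hpq hFm.aemeasurable hgm.aemeasurable
  have h3 : (∫⁻ z, F z ^ p) ^ (1 / p) ≤ ENNReal.ofReal ε := by
    have : ∫⁻ z, F z ^ p = ∫⁻ z in S, ‖f₀ z.1 z.2‖ₑ ^ p := by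
      rw [← lintegral_indicator hSm]
      apply lintegral_congr
      intro z
      by_cases hz : z ∈ S
      · simp [hF, hz]
      · simp [hF, hz, hp0]
    rw [this]
    calc _ ≤ (ENNReal.ofReal (ε ^ p)) ^ (1 / p) := ENNReal.rpow_le_rpow hT (by positivity)
      _ = ENNReal.ofReal ε := by
        rw [← ENNReal.ofReal_rpow_of_nonneg hε hp0.le, ← ENNReal.rpow_mul, mul_one_div_cancel hp0.ne', ENNReal.rpow_one]
  have h4 : (∫⁻ z, g z ^ q) ^ (1 / q) = ENNReal.ofReal ((w ^ 2) ^ (1 / q) * r ^ (3 / q)) := by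
    have : ∫⁻ z, g z ^ q = ENNReal.ofReal (r ^ 3 * w ^ 2) := by
      have e : ∀ z, g z ^ q = U.indicator (fun _ => 1) z := by
        intro z
        by_cases hz : z ∈ U
        · simp [hg, hz]
        · simp [hg, hz, hq0]
      simp_rw [e]
      rw [lintegral_indicator hUm, setLIntegral_const, one_mul, hU, Measure.volume_eq_prod, Measure.prod_prod,
        Measure.addHaar_closedBall' volume x₀ hr.le, ← hv, hvw, ← ENNReal.ofReal_mul (by positivity),
        ← ENNReal.ofReal_mul (by positivity)]
      congr 1
      simp
      ring
    rw [this, ENNReal.ofReal_rpow_of_nonneg (by positivity) (by positivity),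
      Real.mul_rpow (by positivity) (by positivity), ← Real.rpow_natCast r 3, ← Real.rpow_mul hr.le, mul_comm]
    congr 3
    push_cast
    ring
  rw [h4] at h2
  have h5 : ∫⁻ z : E3 × E3, ENNReal.ofReal (η z.1 * f₀ z.1 z.2) ≤
      ENNReal.ofReal (ε * ((w ^ 2) ^ (1 / q) * r ^ (3 / q))) := by
    rw [ENNReal.ofReal_mul hε]
    exact (h1.trans h2).trans (by gcongr)
  rw [mul_assoc]
  exact ENNReal.toReal_le_of_le_ofReal (by positivity) h5

theorem minimizer_compact_support (k M J : ℝ)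
    (hk : 0 < k) (hk2 : k < 2) (hM : 0 < M) (hJ : 0 < J)
    (hlt : energyInf k M J < ENNReal.ofReal M)
    (f₀ : E3 → E3 → ℝ) (φ₀ : E3 → ℝ)
    (hadm : Admissible k M J f₀ φ₀)
    (hmin : energy f₀ φ₀ = energyInf k M J) :
    (∀ᵐ z : E3 × E3, 1 ≤ ‖z.2‖ → f₀ z.1 z.2 = 0)
    ∧ ∃ R : ℝ, 0 < R ∧ ∀ᵐ z : E3 × E3, R ≤ ‖z.1‖ → f₀ z.1 z.2 = 0 := by
  obtain ⟨c, hc0, hc1, hsupp⟩ := support_energy k M J hk hk2 hM hlt f₀ φ₀ hadm hmin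
  have hEtop : energy f₀ φ₀ ≠ ⊤ := by
    rw [hmin]; exact (hlt.trans_le le_top).ne
  have hlow : ∀ (x p : E3), Real.exp (φ₀ x) ≤ Real.sqrt (Real.exp (2 * φ₀ x) + ‖p‖ ^ 2) := by
    intro x p
    apply Real.le_sqrt_of_sq_le
    rw [← Real.exp_nat_mul]
    push_cast
    linarith [sq_nonneg ‖p‖]
  have hp : ∀ᵐ z : E3 × E3, 1 ≤ ‖z.2‖ → f₀ z.1 z.2 = 0 := by
    filter_upwards [hsupp] with z hz h1
    apply hz
    refine lt_of_lt_of_le (hc1.trans_le h1) ?_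
    apply Real.le_sqrt_of_sq_le
    linarith [Real.exp_pos (2 * φ₀ z.1)]
  refine ⟨hp, ?_⟩
  have hneg : ∀ᵐ z : E3 × E3, 0 < φ₀ z.1 → f₀ z.1 z.2 = 0 := by
    filter_upwards [hsupp] with z hz h1
    apply hz
    have : 1 < Real.exp (φ₀ z.1) := Real.one_lt_exp_iff.2 h1
    linarith [hlow z.1 z.2]
  have hmeas : Measurable (fun z : E3 × E3 => f₀ z.1 z.2) := hadm.1.1
  have hC : ContDiff ℝ 1 φ₀ := hadm.2.1.1
  have hLq := hadm.1.2.2.2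
  set s : ℝ := 3 / (1 + k) with hs
  have hs1 : 1 < s := by rw [hs, lt_div_iff₀ (by positivity)]; linarith
  set β : ℝ := - Real.log c with hβ
  have hβ0 : 0 < β := by rw [hβ]; linarith [Real.log_neg hc0 hc1]
  set W : ℝ := ∫ y, omg y with hW
  have hW0 : 0 < W := by
    apply omg_cont.integral_pos_of_hasCompactSupport_nonneg_nonzero omg_supp omg_nonneg (x := 0)
    simp [omg]
  set V : ℝ := ((volume (Metric.closedBall (0 : E3) 1)).toReal ^ 2) ^ (1 / (1 + k)) with hV
  have hV0 : 0 ≤ V := by positivity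
  set ε : ℝ := W * β / 3 * (s - 1) / (V + 1) with hε
  have hs0 : 0 < s - 1 := by linarith
  have hε0 : 0 < ε := by positivity
  set p : ℝ := 1 + 1 / k with hpdef
  have hp0 : 0 < p := by positivity
  have hfin : ∫⁻ z : E3 × E3, ‖f₀ z.1 z.2‖ₑ ^ p ≠ ⊤ := by
    have hne : ENNReal.ofReal p ≠ 0 := by simpa using hp0
    have h := hLq.trans_lt ENNReal.ofReal_lt_top
    have := lintegral_rpow_enorm_lt_top_of_eLpNorm_lt_top hne (by simp) h
    rw [ENNReal.toReal_ofReal hp0.le] at this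
    exact this.ne
  obtain ⟨R1, hR1, hT1⟩ := tail_small (volume : Measure (E3 × E3)) _ hfin (fun z => ‖z.1‖) (by fun_prop)
    (ENNReal.ofReal (ε ^ p)) (by simp; positivity)
  obtain ⟨R2, hR2, hT2⟩ := poinc_tail φ₀ hadm.2.1 (W * β / 3) (by positivity)
  have hfar : ∀ x₀ : E3, R1 + R2 + 1 ≤ ‖x₀‖ → -β < φ₀ x₀ := by
    intro x₀ hx₀
    have hT : ∫⁻ z in (Metric.closedBall x₀ 1) ×ˢ (Set.univ : Set E3), ‖f₀ z.1 z.2‖ₑ ^ p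
        ≤ ENNReal.ofReal (ε ^ p) := by
      refine le_trans (lintegral_mono_set ?_) hT1
      rintro z ⟨hz, -⟩
      have h1 : ‖z.1 - x₀‖ ≤ 1 := by simpa [dist_eq_norm] using hz
      have h2 : ‖x₀‖ ≤ ‖z.1‖ + ‖z.1 - x₀‖ := by
        calc ‖x₀‖ = ‖z.1 - (z.1 - x₀)‖ := by congr 1; abel
          _ ≤ _ := norm_sub_le _ _
      show R1 ≤ ‖z.1‖
      linarith
    have hg := growth φ₀ hC x₀ (ε * V) s hs1 (by
      intro r hr hr1
      refine (weak_EL k M J f₀ φ₀ hadm hmin hEtop hneg (tst x₀ r) (tst_contDiff x₀ r) (tst_supp x₀ r hr)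
        (tst_nonneg x₀ r) (tst_le_one x₀ r)).trans ?_
      exact holder_bound k hk f₀ hmeas hp x₀ r hr hr1 _ (tst_nonneg x₀ r) (tst_le_one x₀ r)
        (tst_zero x₀ r hr) ε hε0.le hT)
    have hb : ε * V / (s - 1) ≤ W * β / 3 := by
      rw [hε, div_le_iff₀ hs0]
      have : V / (V + 1) ≤ 1 := (div_le_one (by positivity)).2 (by linarith)
      calc W * β / 3 * (s - 1) / (V + 1) * V = W * β / 3 * (s - 1) * (V / (V + 1)) := by ring
        _ ≤ W * β / 3 * (s - 1) * 1 := by gcongr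
        _ = _ := by ring
    have havg : |∫ y, omg y * φ₀ (x₀ + y)| ≤ W * β / 3 := by
      have h1 : ‖∫ y, omg y * φ₀ (x₀ + y)‖ₑ ≤ ENNReal.ofReal (W * β / 3) := by
        refine (enorm_integral_le_lintegral_enorm _).trans (le_trans ?_ (hT2 x₀ (by linarith)))
        rw [← lintegral_indicator Metric.isClosed_closedBall.measurableSet,
          ← lintegral_add_left_eq_self ((Metric.closedBall x₀ 1).indicator (fun x => ‖φ₀ x‖ₑ)) x₀]
        apply lintegral_mono
        intro y
        dsimp only
        by_cases hy : ‖y‖ ≤ 1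
        · have : x₀ + y ∈ Metric.closedBall x₀ 1 := by simpa using hy
          rw [Set.indicator_of_mem this, enorm_mul]
          refine mul_le_of_le_one_left zero_le ?_
          rw [Real.enorm_of_nonneg (omg_nonneg y), ENNReal.ofReal_le_one]
          exact omg_le_one y
        · rw [omg_zero (not_le.1 hy).le]
          simp
      rw [← ofReal_norm, ENNReal.ofReal_le_ofReal_iff (by positivity)] at h1
      exact h1
    have h3 := (abs_le.1 havg).1
    have h4 : -(W * β) < φ₀ x₀ * W := by
      have : 0 < W * β := by positivity
      linarith
    nlinarith
  refine ⟨R1 + R2 + 1, by positivity, ?_⟩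
  filter_upwards [hsupp] with z hz hzR
  apply hz
  have h1 := hfar z.1 hzR
  have h2 : c < Real.exp (φ₀ z.1) := by
    rw [← Real.log_lt_iff_lt_exp hc0]
    rw [hβ] at h1
    linarith
  exact h2.trans_le (hlow _ _)
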